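/- arXiv:1207.6503 — 2 statements merged into one kernel-verified Lean document; each statement's English description precedes it below -/
import Mathlib

section
/- Suppose there is an integer α ≥ 1 such that dim_K V(2^m) = 1 for all m ≥ α. Then there is a natural number c such that for every n ≥ 0 the K-subspace T_n = Σ_{i=0}^{n} V^<(i) V^>(n−i) of A(n) has dim_K T_n < c. -/
/-
Formalization of statements from:
"Golod-Shafarevich algebras of a reduced number of defining relations" (A. Smoktunowicz).

`FA K` is the free associative unital `K`-algebra `A = K⟨x,y⟩` on two generators
(`FreeAlgebra.ι K 0` and `FreeAlgebra.ι K 1`), graded with the generators in degree 1.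
-/

open scoped Pointwise Classical

noncomputable section

/-- The free associative unital `K`-algebra on two generators. -/
abbrev FA (K : Type) [Field K] : Type := FreeAlgebra K (Fin 2)

variable (K : Type) [Field K]

/-- The set of monomials of degree `k` in the free algebra on two generators. -/
def Mon (k : ℕ) : Set (FA K) :=
  { m | ∃ w : List (Fin 2), w.length = k ∧ m = (w.map (FreeAlgebra.ι K)).prod }

/-- `Adeg K k` is the `k`-th homogeneous component `A(k)`: the span of the monomials of
degree `k`. -/
def Adeg (k : ℕ) : Submodule K (FA K) :=
  Submodule.span K (Mon K k)

/-- Properties (1)-(4) of the families `U(2^m)`, `V(2^m)` of subspaces of `A(2^m)`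
(Section 1 of the paper):
(1) `V(2^m)` is spanned by monomials (of degree `2^m`);
(2) `V(2^m) + U(2^m) = A(2^m)` and `V(2^m) ∩ U(2^m) = 0`;
(3) `A(2^{m-1})U(2^{m-1}) + U(2^{m-1})A(2^{m-1}) ⊆ U(2^m)`;
(4) `V(2^m) ⊆ V(2^{m-1})V(2^{m-1})`;
with `V(2^0) = Kx + Ky` and `U(2^0) = 0`. -/
def UVCond (U V : ℕ → Submodule K (FA K)) : Prop :=
  V 0 = Submodule.span K {FreeAlgebra.ι K 0, FreeAlgebra.ι K 1} ∧
  U 0 = ⊥ ∧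
  ∀ m : ℕ, 1 ≤ m →
    (∃ s ⊆ Mon K (2 ^ m), V m = Submodule.span K s) ∧
    U m ≤ Adeg K (2 ^ m) ∧
    V m ⊔ U m = Adeg K (2 ^ m) ∧
    V m ⊓ U m = ⊥ ∧
    Adeg K (2 ^ (m - 1)) * U (m - 1) ⊔ U (m - 1) * Adeg K (2 ^ (m - 1)) ≤ U m ∧
    V m ≤ V (m - 1) * V (m - 1)

/-- The homogeneous component `E(k)` (as a set), for `k ≥ 1`.  For the unique `n` with
`2^(n-1) ≤ k < 2^n` (i.e. `n = Nat.log 2 k + 1`) it consists of those `r ∈ A(k)` with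
`A r A ∩ A(2^(n+1)) ⊆ U(2^n)A(2^n) + A(2^n)U(2^n)`; here `A r A` is the two-sided ideal
generated by `r`, realized as the subspace `⊤ * span{r} * ⊤`. -/
def ESet (U : ℕ → Submodule K (FA K)) (k : ℕ) : Set (FA K) :=
  { r | r ∈ Adeg K k ∧
    (⊤ : Submodule K (FA K)) * Submodule.span K {r} * ⊤ ⊓ Adeg K (2 ^ (Nat.log 2 k + 2)) ≤
      U (Nat.log 2 k + 1) * Adeg K (2 ^ (Nat.log 2 k + 1)) ⊔
        Adeg K (2 ^ (Nat.log 2 k + 1)) * U (Nat.log 2 k + 1) }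

/-- The graded subspace `E = ⊕_{k ≥ 1} E(k)` (each `E(k)` is a subspace, so the span of the
union of the `E(k)` is their direct sum). -/
def Esub (U : ℕ → Submodule K (FA K)) : Submodule K (FA K) :=
  Submodule.span K (⋃ k ∈ Set.Ici 1, ESet K U k)

/-- Auxiliary: the product of the `V(2^p)` over the set bits of `k`, lowest bit first,
with bit positions shifted by `i`. -/
def prodLow (V : ℕ → Submodule K (FA K)) (i k : ℕ) : Submodule K (FA K) :=
  if _h : k = 0 then 1
  else (if k % 2 = 1 then V i else 1) * prodLow V (i + 1) (k / 2)
termination_by k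
decreasing_by exact Nat.div_lt_self (Nat.pos_of_ne_zero _h) one_lt_two

/-- Auxiliary: the product of the `V(2^p)` over the set bits of `k`, highest bit first. -/
def prodHigh (V : ℕ → Submodule K (FA K)) (i k : ℕ) : Submodule K (FA K) :=
  if _h : k = 0 then 1
  else prodHigh V (i + 1) (k / 2) * (if k % 2 = 1 then V i else 1)
termination_by k
decreasing_by exact Nat.div_lt_self (Nat.pos_of_ne_zero _h) one_lt_two

/-- `V^<(k) = V(2^{p_1}) ⋯ V(2^{p_t})` where `k = 2^{p_1} + ⋯ + 2^{p_t}` in binary with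
`p_1 < ⋯ < p_t`; `V^<(0) = K·1`. -/
def Vlt (V : ℕ → Submodule K (FA K)) (k : ℕ) : Submodule K (FA K) := prodLow K V 0 k

/-- `V^>(k) = V(2^{p_t}) ⋯ V(2^{p_1})`; `V^>(0) = K·1`. -/
def Vgt (V : ℕ → Submodule K (FA K)) (k : ℕ) : Submodule K (FA K) := prodHigh K V 0 k

/-- `U^<(k) = Σ_i A(2^{p_1}+⋯+2^{p_{i-1}}) U(2^{p_i}) A(2^{p_{i+1}}+⋯+2^{p_t})`
(for each set bit `p_i` of `k`, the lower part of `k` is `k % 2^{p_i}` and the upper part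
is `k - k % 2^{p_i} - 2^{p_i}`); `U^<(0) = 0`. -/
def Ult (U : ℕ → Submodule K (FA K)) (k : ℕ) : Submodule K (FA K) :=
  ⨆ (p : ℕ) (_ : k.testBit p),
    Adeg K (k % 2 ^ p) * U p * Adeg K (k - k % 2 ^ p - 2 ^ p)

/-- `U^>(k) = Σ_i A(2^{p_t}+⋯+2^{p_{i+1}}) U(2^{p_i}) A(2^{p_{i-1}}+⋯+2^{p_1})`;
`U^>(0) = 0`. -/
def Ugt (U : ℕ → Submodule K (FA K)) (k : ℕ) : Submodule K (FA K) :=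
  ⨆ (p : ℕ) (_ : k.testBit p),
    Adeg K (k - k % 2 ^ p - 2 ^ p) * U p * Adeg K (k % 2 ^ p)

/-- The Capelli polynomial
`d_n(x_1,…,x_n; y_1,…,y_n) = Σ_{σ ∈ Sym(n)} sgn(σ) x_{σ(1)} y_1 x_{σ(2)} y_2 ⋯ x_{σ(n)} y_n`,
evaluated in a ring. -/
def capelli {R : Type*} [Ring R] (n : ℕ) (x y : Fin n → R) : R :=
  ∑ σ : Equiv.Perm (Fin n),
    (Equiv.Perm.sign σ : ℤ) • ((List.finRange n).map fun i => x (σ i) * y i).prod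

/-- The quotient map `R → R ⧸ c` (for a ring congruence `c`) as a `K`-linear map. -/
def mkLin {R : Type*} [Semiring R] [Algebra K R] (c : RingCon R) :
    R →ₗ[K] c.Quotient where
  toFun := RingCon.toQuotient
  map_add' _ _ := rfl
  map_smul' _ _ := rfl

/-- A two-sided ideal of the free algebra is homogeneous iff it is spanned by its
homogeneous elements. -/
def IsHomogTSI (J : TwoSidedIdeal (FA K)) : Prop :=
  (J : Set (FA K)) ⊆ ↑(Submodule.span K {a : FA K | a ∈ J ∧ ∃ n, a ∈ Adeg K n})

/-- `S = ⋃_{n ∈ Y} {n - e(n) - 1, …, n - 1}`. -/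
def SetS (Y : Set ℕ) (e : ℕ → ℕ) : Set ℕ :=
  ⋃ n ∈ Y, Set.Icc (n - e n - 1) (n - 1)

/-- Conditions (1)-(8) of Theorem 4.1 of the paper, at index `m`, for the families
`F(2^m)`, `U(2^m)`, `V(2^m)` of subspaces of `A(2^m)`:
(1) `dim V(2^m) = 2` if `m ∉ S` and (in case `Y` is finite) `m ≤ max Y`;
(2) `dim V(2^{k-e(k)-1+j}) = 2^{2^j}` for all `k ∈ Y` and `0 ≤ j ≤ e(k)`;
(3) `V(2^m)` is spanned by monomials;
(4) `F(2^m) ⊆ U(2^m)` for `m ∈ Y`, and `F(2^m) = 0` for `m ∉ Y`;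
(5) `V(2^m) ⊕ U(2^m) = A(2^m)`;
(6) `A(2^{m-1})U(2^{m-1}) + U(2^{m-1})A(2^{m-1}) ⊆ U(2^m)`;
(7) `V(2^m) ⊆ V(2^{m-1})V(2^{m-1})`;
(8) if `Y` is finite and `m > max Y`, then `dim V(2^m) = 1`. -/
def Conds (Y : Set ℕ) (e : ℕ → ℕ) (F U V : ℕ → Submodule K (FA K)) (m : ℕ) : Prop :=
  (m ∉ SetS Y e → (Y.Finite → ∃ k ∈ Y, m ≤ k) → Module.finrank K (V m) = 2) ∧
  (∀ k ∈ Y, ∀ j ≤ e k, k - e k - 1 + j = m → Module.finrank K (V m) = 2 ^ 2 ^ j) ∧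
  (∃ s ⊆ Mon K (2 ^ m), V m = Submodule.span K s) ∧
  (m ∈ Y → F m ≤ U m) ∧ (m ∉ Y → F m = ⊥) ∧
  U m ≤ Adeg K (2 ^ m) ∧
  V m ⊔ U m = Adeg K (2 ^ m) ∧ V m ⊓ U m = ⊥ ∧
  (Adeg K (2 ^ (m - 1)) * U (m - 1) ⊔ U (m - 1) * Adeg K (2 ^ (m - 1)) ≤ U m) ∧
  V m ≤ V (m - 1) * V (m - 1) ∧
  (Y.Finite → (∀ k ∈ Y, k < m) → Module.finrank K (V m) = 1)

section

variable {K}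

lemma prodLow_eq (V : ℕ → Submodule K (FA K)) (i k : ℕ) :
    prodLow K V i k = (if k % 2 = 1 then V i else 1) * prodLow K V (i + 1) (k / 2) := by
  rcases eq_or_ne k 0 with rfl | hk
  · simp [prodLow]
  · rw [prodLow, dif_neg hk]

lemma prodHigh_eq (V : ℕ → Submodule K (FA K)) (i k : ℕ) :
    prodHigh K V i k = prodHigh K V (i + 1) (k / 2) * (if k % 2 = 1 then V i else 1) := by
  rcases eq_or_ne k 0 with rfl | hk
  · simp [prodHigh]
  · rw [prodHigh, dif_neg hk]

lemma mod_two_pow_succ_div_two (k a : ℕ) : k % 2 ^ (a + 1) / 2 = k / 2 % 2 ^ a := by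
  rw [pow_succ', Nat.mod_mul_right_div_self]

lemma mod_two_pow_succ_mod_two (k a : ℕ) : k % 2 ^ (a + 1) % 2 = k % 2 :=
  Nat.mod_mod_of_dvd _ (dvd_pow_self 2 a.succ_ne_zero)

lemma div_two_pow_succ (k a : ℕ) : k / 2 ^ (a + 1) = k / 2 / 2 ^ a := by
  rw [pow_succ', Nat.div_div_eq_div_mul]

/-- The low product splits into the contributions of the lowest `a` bits and of the others. -/
lemma prodLow_split (V : ℕ → Submodule K (FA K)) (a i k : ℕ) :
    prodLow K V i k = prodLow K V i (k % 2 ^ a) * prodLow K V (i + a) (k / 2 ^ a) := by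
  induction a generalizing i k with
  | zero => simp [Nat.mod_one, prodLow.eq_1 K V i 0]
  | succ a ih =>
    rw [prodLow_eq V i k, prodLow_eq V i (k % 2 ^ (a + 1)), mod_two_pow_succ_mod_two,
      mod_two_pow_succ_div_two, div_two_pow_succ, ih, mul_assoc, Nat.add_right_comm, Nat.add_assoc]

/-- The high product splits into the contributions of the lowest `a` bits and of the others. -/
lemma prodHigh_split (V : ℕ → Submodule K (FA K)) (a i k : ℕ) :
    prodHigh K V i k = prodHigh K V (i + a) (k / 2 ^ a) * prodHigh K V i (k % 2 ^ a) := by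
  induction a generalizing i k with
  | zero => simp [Nat.mod_one, prodHigh.eq_1 K V i 0]
  | succ a ih =>
    rw [prodHigh_eq V i k, prodHigh_eq V i (k % 2 ^ (a + 1)), mod_two_pow_succ_mod_two,
      mod_two_pow_succ_div_two, div_two_pow_succ, ih, mul_assoc, Nat.add_right_comm, Nat.add_assoc]

lemma prodLow_eq_span_pow {V : ℕ → Submodule K (FA K)} {i : ℕ} {w : FA K}
    (h : ∀ j, V (i + j) = Submodule.span K {w ^ 2 ^ j}) (j q : ℕ) :
    prodLow K V (i + j) q = Submodule.span K {w ^ (2 ^ j * q)} := by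
  induction q using Nat.strong_induction_on generalizing j with
  | _ q ih =>
    rcases eq_or_ne q 0 with rfl | hq
    · simp [prodLow, Submodule.one_eq_span]
    · rw [prodLow_eq, Nat.add_assoc, ih _ (by omega)]
      have hdecomp := Nat.div_add_mod q 2
      split_ifs with hodd
      · rw [h, Submodule.span_mul_span, Set.singleton_mul_singleton, ← pow_add]
        rw [show 2 ^ j + 2 ^ (j + 1) * (q / 2) = 2 ^ j * (2 * (q / 2) + 1) by ring,
          show 2 * (q / 2) + 1 = q by omega]
      · rw [one_mul, pow_succ, mul_assoc, show 2 * (q / 2) = q by omega]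

lemma prodHigh_eq_span_pow {V : ℕ → Submodule K (FA K)} {i : ℕ} {w : FA K}
    (h : ∀ j, V (i + j) = Submodule.span K {w ^ 2 ^ j}) (j q : ℕ) :
    prodHigh K V (i + j) q = Submodule.span K {w ^ (2 ^ j * q)} := by
  induction q using Nat.strong_induction_on generalizing j with
  | _ q ih =>
    rcases eq_or_ne q 0 with rfl | hq
    · simp [prodHigh, Submodule.one_eq_span]
    · rw [prodHigh_eq, Nat.add_assoc, ih _ (by omega)]
      have hdecomp := Nat.div_add_mod q 2
      split_ifs with hodd
      · rw [h, Submodule.span_mul_span, Set.singleton_mul_singleton, ← pow_add]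
        rw [show 2 ^ (j + 1) * (q / 2) + 2 ^ j = 2 ^ j * (2 * (q / 2) + 1) by ring,
          show 2 * (q / 2) + 1 = q by omega]
      · rw [mul_one, pow_succ, mul_assoc, show 2 * (q / 2) = q by omega]

lemma fg_prodLow {V : ℕ → Submodule K (FA K)} (h : ∀ m, (V m).FG) (i k : ℕ) :
    (prodLow K V i k).FG := by
  induction k using Nat.strong_induction_on generalizing i with
  | _ k ih =>
    rcases eq_or_ne k 0 with rfl | hk
    · rw [prodLow, dif_pos rfl, Submodule.one_eq_span]
      exact Submodule.fg_span_singleton _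
    · rw [prodLow_eq]
      refine Submodule.FG.mul ?_ (ih _ (by omega) _)
      split_ifs
      · exact h i
      · rw [Submodule.one_eq_span]
        exact Submodule.fg_span_singleton _

lemma fg_prodHigh {V : ℕ → Submodule K (FA K)} (h : ∀ m, (V m).FG) (i k : ℕ) :
    (prodHigh K V i k).FG := by
  induction k using Nat.strong_induction_on generalizing i with
  | _ k ih =>
    rcases eq_or_ne k 0 with rfl | hk
    · rw [prodHigh, dif_pos rfl, Submodule.one_eq_span]
      exact Submodule.fg_span_singleton _
    · rw [prodHigh_eq]
      refine Submodule.FG.mul (ih _ (by omega) _) ?_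
      split_ifs
      · exact h i
      · rw [Submodule.one_eq_span]
        exact Submodule.fg_span_singleton _

lemma fg_of_le {P Q : Submodule K (FA K)} (hQ : Q.FG) (h : P ≤ Q) : P.FG := by
  have : FiniteDimensional K Q := Module.Finite.iff_fg.mpr hQ
  exact Module.Finite.iff_fg.mp (Submodule.finiteDimensional_of_le h)

lemma UVCond.fg {U V : ℕ → Submodule K (FA K)} (h : UVCond K U V) (m : ℕ) : (V m).FG := by
  induction m with
  | zero => rw [h.1]; exact Submodule.fg_span (Set.toFinite _)
  | succ m ih =>
    obtain ⟨-, -, -, -, -, hle⟩ := h.2.2 (m + 1) m.succ_pos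
    exact fg_of_le (ih.mul ih) hle

/-- From the index on from which the `V(2^m)` are lines, they are spanned by the successive
squarings of a single element. -/
lemma UVCond.exists_eq_span_pow {U V : ℕ → Submodule K (FA K)} (h : UVCond K U V) {α : ℕ}
    (hdim : ∀ m, α ≤ m → Module.finrank K (V m) = 1) :
    ∃ w : FA K, ∀ j, V (α + j) = Submodule.span K {w ^ 2 ^ j} := by
  obtain ⟨w, -, hgen⟩ := finrank_eq_one_iff'.mp (hdim α le_rfl)
  have hw : V α = Submodule.span K {(w : FA K)} := by
    refine le_antisymm (fun v hv => ?_) (by simp)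
    obtain ⟨c, hc⟩ := hgen ⟨v, hv⟩
    exact Submodule.mem_span_singleton.mpr ⟨c, congrArg Subtype.val hc⟩
  refine ⟨(w : FA K), fun j => ?_⟩
  induction j with
  | zero => simpa using hw
  | succ j ih =>
    obtain ⟨-, -, -, -, -, hle⟩ := h.2.2 (α + (j + 1)) (by omega)
    rw [show α + (j + 1) - 1 = α + j by omega, ih, Submodule.span_mul_span,
      Set.singleton_mul_singleton, ← pow_add, ← two_mul, ← pow_succ'] at hle
    refine Submodule.eq_of_le_of_finrank_le hle ?_
    rw [hdim _ (by omega)]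
    simpa using finrank_span_le_card (R := K) ({(w : FA K) ^ 2 ^ (j + 1)} : Set (FA K))

lemma div_add_div_sub_eq {N i n : ℕ} (hN : 0 < N) (hi : i ≤ n) :
    i / N + (n - i) / N = n / N ∨ i / N + (n - i) / N = n / N - 1 := by
  obtain ⟨j, rfl⟩ := Nat.exists_eq_add_of_le hi
  rw [Nat.add_sub_cancel_left, Nat.add_div hN]
  split_ifs <;> simp

end

/-- **Lemma 2.1.**  If `dim V(2^m) = 1` for all `m ≥ α`, then the dimensions of the
subspaces `T_n = Σ_{i=0}^{n} V^<(i) V^>(n−i)` are uniformly bounded. -/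
theorem statement6 (U V : ℕ → Submodule K (FA K)) (hUV : UVCond K U V)
    (α : ℕ) (hα : 1 ≤ α) (hdim : ∀ m, α ≤ m → Module.finrank K (V m) = 1) :
    ∃ c : ℕ, ∀ n : ℕ,
      Module.rank K ↥(⨆ i ∈ Finset.range (n + 1), Vlt K V i * Vgt K V (n - i)) <
        (c : Cardinal) := by
  obtain ⟨w, hw⟩ := hUV.exists_eq_span_pow hdim
  obtain ⟨S, hS⟩ : (⨆ a ∈ Finset.range (2 ^ α), Vlt K V a).FG :=
    Submodule.fg_biSup _ _ fun a _ => fg_prodLow hUV.fg 0 a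
  obtain ⟨T, hT⟩ : (⨆ a ∈ Finset.range (2 ^ α), Vgt K V a).FG :=
    Submodule.fg_biSup _ _ fun a _ => fg_prodHigh hUV.fg 0 a
  refine ⟨S.card * 2 * T.card + 1, fun n => ?_⟩
  let P : Finset (FA K) := {w ^ (n / 2 ^ α), w ^ (n / 2 ^ α - 1)}
  have hle : (⨆ i ∈ Finset.range (n + 1), Vlt K V i * Vgt K V (n - i)) ≤
      Submodule.span K ((S * P * T : Finset (FA K)) : Set (FA K)) := by
    refine iSup₂_le fun i hi => ?_
    have hlow : Vlt K V i = Vlt K V (i % 2 ^ α) * Submodule.span K {w ^ (i / 2 ^ α)} := by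
      simpa [Vlt] using (prodLow_split V α 0 i).trans
        (congrArg _ (by simpa using prodLow_eq_span_pow hw 0 (i / 2 ^ α)))
    have hhigh : Vgt K V (n - i) =
        Submodule.span K {w ^ ((n - i) / 2 ^ α)} * Vgt K V ((n - i) % 2 ^ α) := by
      simpa [Vgt] using (prodHigh_split V α 0 (n - i)).trans
        (congrArg (· * _) (by simpa using prodHigh_eq_span_pow hw 0 ((n - i) / 2 ^ α)))
    have hmod (k : ℕ) : k % 2 ^ α ∈ Finset.range (2 ^ α) :=
      Finset.mem_range.mpr (Nat.mod_lt _ (by positivity))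
    rw [hlow, hhigh, mul_assoc, ← mul_assoc (Submodule.span K _), Submodule.span_mul_span,
      Set.singleton_mul_singleton, ← pow_add, ← mul_assoc, Finset.coe_mul, Finset.coe_mul,
      ← Submodule.span_mul_span, ← Submodule.span_mul_span, hS, hT]
    refine mul_le_mul' (mul_le_mul' (le_iSup₂_of_le _ (hmod i) le_rfl) ?_)
      (le_iSup₂_of_le _ (hmod (n - i)) le_rfl)
    refine Submodule.span_mono (Set.singleton_subset_iff.mpr ?_)
    rcases div_add_div_sub_eq (N := 2 ^ α) (by positivity)
      (Nat.lt_succ_iff.mp (Finset.mem_range.mp hi)) with h | h <;> simp [P, h]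
  have hcard : (S * P * T).card ≤ S.card * 2 * T.card :=
    Finset.card_mul_le.trans <| Nat.mul_le_mul_right _ <|
      Finset.card_mul_le.trans <| Nat.mul_le_mul_left _ Finset.card_le_two
  calc Module.rank K ↥(⨆ i ∈ Finset.range (n + 1), Vlt K V i * Vgt K V (n - i))
      ≤ Module.rank K (Submodule.span K ((S * P * T : Finset (FA K)) : Set (FA K))) :=
        Submodule.rank_mono hle
    _ ≤ ((S * P * T).card : Cardinal) := rank_span_finset_le _
    _ < ((S.card * 2 * T.card + 1 : ℕ) : Cardinal) := by
        exact_mod_cast Nat.lt_succ_of_le hcard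

end
end

section
/- Suppose there is an integer α ≥ 1 such that dim_K V(2^m) = 1 for all m ≥ α, and let c be a natural number such that dim_K ( Σ_{i=0}^{n} V^<(i) V^>(n−i) ) ≤ c for all n ≥ 0. Let n ≥ 1, let m_1, …, m_{c+1} be monomials of degree n in A, and let r_1, …, r_{c+1} be monomials in A such that deg(r_i) + n is divisible by 2^α for every i ≤ c+1. Then d_{c+1}(m_1, …, m_{c+1}; r_1, …, r_{c+1}) ∈ E. -/
/-
Formalization of statements from:
"Golod-Shafarevich algebras of a reduced number of defining relations" (A. Smoktunowicz).

`FA K` is the free associative unital `K`-algebra `A = K⟨x,y⟩` on two generators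
(`FreeAlgebra.ι K 0` and `FreeAlgebra.ι K 1`), graded with the generators in degree 1.
-/

open scoped Pointwise Classical

noncomputable section

variable (K : Type) [Field K]

section Graded

variable {K}

theorem Mon.mul_mem {a b : ℕ} {p q : FA K} (hp : p ∈ Mon K a) (hq : q ∈ Mon K b) :
    p * q ∈ Mon K (a + b) := by
  obtain ⟨u, rfl, rfl⟩ := hp
  obtain ⟨v, rfl, rfl⟩ := hq
  exact ⟨u ++ v, by simp, by simp⟩

theorem Mon.one_mem : (1 : FA K) ∈ Mon K 0 := ⟨[], rfl, by simp⟩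

theorem Mon.mul_subset_eq (a b : ℕ) : Mon K a * Mon K b = Mon K (a + b) := by
  ext z
  constructor
  · rintro ⟨p, hp, q, hq, rfl⟩
    exact Mon.mul_mem hp hq
  · rintro ⟨w, hw, rfl⟩
    refine ⟨_, ⟨w.take a, by simp; omega, rfl⟩, _, ⟨w.drop a, by simp; omega, rfl⟩, ?_⟩
    simp only [← List.prod_append, ← List.map_append, List.take_append_drop]

theorem Adeg_mul (a b : ℕ) : Adeg K a * Adeg K b = Adeg K (a + b) := by
  rw [Adeg, Adeg, Submodule.span_mul_span, Mon.mul_subset_eq, Adeg]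

theorem Adeg_zero : Adeg K 0 = 1 := by
  rw [Adeg, Submodule.one_eq_span]
  congr 1
  ext z
  simp [Mon]

theorem Adeg_one :
    Adeg K 1 = Submodule.span K {FreeAlgebra.ι K (0 : Fin 2), FreeAlgebra.ι K 1} := by
  rw [Adeg]
  congr 1
  ext z
  simp only [Mon, List.length_eq_one_iff, Set.mem_ofPred_eq, Set.mem_insert_iff,
    Set.mem_singleton_iff]
  constructor
  · rintro ⟨_, ⟨i, rfl⟩, rfl⟩
    fin_cases i <;> simp
  · rintro (rfl | rfl)
    · exact ⟨_, ⟨0, rfl⟩, by simp⟩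
    · exact ⟨_, ⟨1, rfl⟩, by simp⟩

theorem span_iUnion_Mon : Submodule.span K (⋃ k, Mon K k) = ⊤ := by
  have hmul : ∀ a b : FA K, a ∈ Submodule.span K (⋃ k, Mon K k) →
      b ∈ Submodule.span K (⋃ k, Mon K k) → a * b ∈ Submodule.span K (⋃ k, Mon K k) := by
    intro a b ha hb
    have h := Submodule.mul_mem_mul ha hb
    rw [Submodule.span_mul_span] at h
    refine Submodule.span_mono ?_ h
    rintro _ ⟨p, hp, q, hq, rfl⟩
    obtain ⟨i, hi⟩ := Set.mem_iUnion.1 hp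
    obtain ⟨j, hj⟩ := Set.mem_iUnion.1 hq
    exact Set.mem_iUnion.2 ⟨i + j, Mon.mul_mem hi hj⟩
  rw [eq_top_iff]
  rintro a -
  induction a using FreeAlgebra.induction with
  | grade0 r =>
    rw [Algebra.algebraMap_eq_smul_one]
    exact Submodule.smul_mem _ _
      (Submodule.subset_span (Set.mem_iUnion.2 ⟨0, Mon.one_mem⟩))
  | grade1 i =>
    exact Submodule.subset_span (Set.mem_iUnion.2 ⟨1, [i], rfl, by simp⟩)
  | mul a b ha hb => exact hmul a b ha hb
  | add a b ha hb => exact Submodule.add_mem _ ha hb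

/-- The algebra map sending a homogeneous element `a` of degree `k` to `a X ^ k`. -/
def gradeHom : FA K →ₐ[K] Polynomial (FA K) :=
  FreeAlgebra.lift K fun i => Polynomial.C (FreeAlgebra.ι K i) * Polynomial.X

theorem gradeHom_of_mem_Mon {k : ℕ} {p : FA K} (hp : p ∈ Mon K k) :
    gradeHom p = Polynomial.C p * Polynomial.X ^ k := by
  obtain ⟨w, rfl, rfl⟩ := hp
  induction w with
  | nil => simp
  | cons i w ih =>
    rw [List.map_cons, List.prod_cons, map_mul, ih, List.length_cons, pow_succ', map_mul,
      gradeHom, FreeAlgebra.lift_ι_apply, mul_assoc, mul_assoc, ← mul_assoc Polynomial.X,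
      Polynomial.X_mul_C, mul_assoc]

/-- The projection of the free algebra onto its component of degree `k`. -/
def degProj (k : ℕ) : FA K →ₗ[K] FA K where
  toFun a := (gradeHom a).coeff k
  map_add' a b := by simp
  map_smul' r a := by simp

theorem degProj_of_mem_Adeg {j : ℕ} (k : ℕ) {a : FA K} (ha : a ∈ Adeg K j) :
    degProj k a = if k = j then a else 0 := by
  induction ha using Submodule.span_induction with
  | mem p hp =>
    simp [degProj, gradeHom_of_mem_Mon hp, Polynomial.coeff_C_mul, Polynomial.coeff_X_pow]
  | zero => simp
  | add a b _ _ ha hb => rw [map_add, ha, hb]; split <;> simp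
  | smul r a _ ha => rw [map_smul, ha]; split <;> simp

/-- To bound the component of degree `M` of the ideal generated by a homogeneous element `d`,
it suffices to consider products `e * d * f` with monomials `e`, `f`. -/
theorem ideal_inf_Adeg_le {N M : ℕ} {d : FA K} (hd : d ∈ Adeg K N) {B : Submodule K (FA K)}
    (h : ∀ a b, a + N + b = M → ∀ e ∈ Mon K a, ∀ f ∈ Mon K b, e * d * f ∈ B) :
    (⊤ : Submodule K (FA K)) * Submodule.span K {d} * ⊤ ⊓ Adeg K M ≤ B := by
  rintro z ⟨hz, hzM⟩
  have hle : (⊤ : Submodule K (FA K)) * Submodule.span K {d} * ⊤ ≤ B.comap (degProj M) := by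
    rw [← span_iUnion_Mon, Submodule.span_mul_span, Submodule.span_mul_span,
      Submodule.span_le]
    rintro _ ⟨_, ⟨e, he, d, rfl, rfl⟩, f, hf, rfl⟩
    obtain ⟨a, ha⟩ := Set.mem_iUnion.1 he
    obtain ⟨b, hb⟩ := Set.mem_iUnion.1 hf
    simp only [SetLike.mem_coe, Submodule.mem_comap]
    have hdeg : e * d * f ∈ Adeg K (a + N + b) := by
      rw [← Adeg_mul, ← Adeg_mul]
      exact Submodule.mul_mem_mul (Submodule.mul_mem_mul (Submodule.subset_span ha) hd)
        (Submodule.subset_span hb)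
    rw [degProj_of_mem_Adeg M hdeg]
    split_ifs with hM
    · exact h a b hM.symm e ha f hb
    · exact B.zero_mem
  have := hle hz
  rwa [Submodule.mem_comap, degProj_of_mem_Adeg M hzM, if_pos rfl] at this

end Graded

section Dyadic

variable {K} {U V : ℕ → Submodule K (FA K)}

theorem UVCond.adeg_le (h : UVCond K U V) (m : ℕ) : Adeg K (2 ^ m) ≤ V m ⊔ U m := by
  obtain rfl | hm := Nat.eq_zero_or_pos m
  · rw [pow_zero, Adeg_one, h.1]
    exact le_sup_left
  · exact (h.2.2 m hm).2.2.1.ge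

theorem UVCond.V_le (h : UVCond K U V) (m : ℕ) : V m ≤ Adeg K (2 ^ m) := by
  obtain rfl | hm := Nat.eq_zero_or_pos m
  · rw [pow_zero, Adeg_one, h.1]
  · exact le_sup_left.trans (h.2.2 m hm).2.2.1.le

theorem UVCond.U_le (h : UVCond K U V) (m : ℕ) : U m ≤ Adeg K (2 ^ m) := by
  obtain rfl | hm := Nat.eq_zero_or_pos m
  · rw [h.2.1]
    exact bot_le
  · exact (h.2.2 m hm).2.1

theorem UVCond.adeg_mul_U_le (h : UVCond K U V) (m : ℕ) :
    Adeg K (2 ^ m) * U m ≤ U (m + 1) :=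
  le_sup_left.trans (h.2.2 (m + 1) (by omega)).2.2.2.2.1

theorem UVCond.U_mul_adeg_le (h : UVCond K U V) (m : ℕ) :
    U m * Adeg K (2 ^ m) ≤ U (m + 1) :=
  le_sup_right.trans (h.2.2 (m + 1) (by omega)).2.2.2.2.1

/-- If `V(2^m)` and `V(2^(m+1))` are one-dimensional, then
`U(2^(m+1)) = A(2^m)U(2^m) + U(2^m)A(2^m)`. -/
theorem UVCond.U_succ_le (h : UVCond K U V) {m : ℕ} (h1 : Module.finrank K (V m) = 1)
    (h2 : Module.finrank K (V (m + 1)) = 1) :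
    U (m + 1) ≤ Adeg K (2 ^ m) * U m ⊔ U m * Adeg K (2 ^ m) := by
  have hVV : V m * V m ≤ V (m + 1) := by
    obtain ⟨v, hv⟩ : ∃ v, V m = Submodule.span K {v} := by
      obtain ⟨v, -, hv⟩ := finrank_eq_one_iff'.1 h1
      refine ⟨v, le_antisymm (fun w hw => ?_) ?_⟩
      · obtain ⟨t, ht⟩ := hv ⟨w, hw⟩
        exact Submodule.mem_span_singleton.2 ⟨t, congrArg Subtype.val ht⟩
      · rw [Submodule.span_singleton_le_iff_mem]
        exact v.2
    have hle := (h.2.2 (m + 1) (by omega)).2.2.2.2.2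
    have hne : V (m + 1) ≠ ⊥ := by
      intro hb
      rw [hb, finrank_bot] at h2
      omega
    obtain ⟨w, hw, hw0⟩ := (Submodule.ne_bot_iff _).1 hne
    rw [Nat.add_sub_cancel, hv, Submodule.span_mul_span, Set.singleton_mul_singleton] at hle
    rw [hv, Submodule.span_mul_span, Set.singleton_mul_singleton,
      Submodule.span_singleton_le_iff_mem]
    obtain ⟨t, rfl⟩ := Submodule.mem_span_singleton.1 (hle hw)
    have ht : t ≠ 0 := by rintro rfl; simp at hw0
    simpa [smul_smul, ht] using (V (m + 1)).smul_mem t⁻¹ hw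
  set L := Adeg K (2 ^ m) * U m ⊔ U m * Adeg K (2 ^ m) with hL
  have hLU : L ≤ U (m + 1) := sup_le (h.adeg_mul_U_le m) (h.U_mul_adeg_le m)
  have hA : Adeg K (2 ^ (m + 1)) ≤ L ⊔ V (m + 1) := by
    calc Adeg K (2 ^ (m + 1)) = Adeg K (2 ^ m) * Adeg K (2 ^ m) := by
          rw [Adeg_mul]; congr 1; ring
      _ ≤ Adeg K (2 ^ m) * (V m ⊔ U m) := mul_le_mul_right (h.adeg_le m) _
      _ ≤ L ⊔ V (m + 1) := by
          rw [Submodule.mul_sup]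
          refine sup_le ?_ (le_sup_left.trans le_sup_left)
          refine (mul_le_mul_left (h.adeg_le m) _).trans ?_
          rw [Submodule.sup_mul]
          exact sup_le (hVV.trans le_sup_right)
            (((mul_le_mul_right (h.V_le m) _).trans le_sup_right).trans le_sup_left)
  calc U (m + 1) ≤ (L ⊔ V (m + 1)) ⊓ U (m + 1) :=
        le_inf ((h.U_le _).trans hA) le_rfl
    _ = L ⊔ V (m + 1) ⊓ U (m + 1) := sup_inf_assoc_of_le _ hLU
    _ ≤ L := by rw [(h.2.2 (m + 1) (by omega)).2.2.2.1, sup_bot_eq]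

/-- An aligned copy of `U(2^s)` inside `A(2^(k+1))` lies in `U(2^k)A(2^k) + A(2^k)U(2^k)`. -/
theorem UVCond.aligned_le (h : UVCond K U V) {k s : ℕ} (hs : s ≤ k) {b c : ℕ}
    (hb : 2 ^ s ∣ b) (hM : b + 2 ^ s + c = 2 ^ (k + 1)) :
    Adeg K b * U s * Adeg K c ≤ U k * Adeg K (2 ^ k) ⊔ Adeg K (2 ^ k) * U k := by
  induction hs using Nat.decreasingInduction generalizing b c with
  | self =>
    obtain ⟨j, rfl⟩ := hb
    have hpos : 0 < 2 ^ k := by positivity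
    rw [pow_succ] at hM
    obtain rfl | rfl | hj : j = 0 ∨ j = 1 ∨ 2 ≤ j := by omega
    · obtain rfl : c = 2 ^ k := by omega
      rw [mul_zero, Adeg_zero, one_mul]
      exact le_sup_left
    · obtain rfl : c = 0 := by omega
      rw [mul_one, Adeg_zero, mul_one]
      exact le_sup_right
    · nlinarith
  | of_succ s hs ih =>
    obtain ⟨j, rfl⟩ := hb
    obtain ⟨i, rfl | rfl⟩ := Nat.even_or_odd' j
    · obtain ⟨c, rfl⟩ : ∃ c', c = 2 ^ s + c' := by
        obtain ⟨l, rfl⟩ := Nat.exists_eq_add_of_le (Nat.succ_le_of_lt hs)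
        have e : 2 ^ (s.succ + l + 1) = 2 ^ s * (2 * (2 * 2 ^ l)) := by
          rw [Nat.succ_eq_add_one]; ring
        rw [e] at hM
        refine Nat.exists_eq_add_of_le ?_
        have hpos : 0 < 2 ^ s := by positivity
        have hlt : 2 * i < 2 * (2 * 2 ^ l) := by
          by_contra hcon
          have := Nat.mul_le_mul_left (2 ^ s) (not_lt.1 hcon)
          omega
        have := Nat.mul_le_mul_left (2 ^ s) (show 2 * i + 2 ≤ 2 * (2 * 2 ^ l) by omega)
        rw [mul_add] at this
        omega
      rw [← Adeg_mul, ← mul_assoc, mul_assoc (Adeg K _) (U s)]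
      refine (mul_le_mul_left (mul_le_mul_right (h.U_mul_adeg_le s) _) _).trans
        (ih ⟨i, by ring⟩ ?_)
      rw [← hM]; ring
    · rw [show 2 ^ s * (2 * i + 1) = 2 ^ (s + 1) * i + 2 ^ s by ring, ← Adeg_mul,
        mul_assoc (Adeg K _) (Adeg K _)]
      refine (mul_le_mul_left (mul_le_mul_right (h.adeg_mul_U_le s) _) _).trans
        (ih ⟨i, rfl⟩ ?_)
      rw [← hM]; ring

/-- When `dim V(2^m) = 1` for all `m ≥ α`, a copy of `U(2^s)` with `s ≥ α` only has to be aligned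
modulo `2^α`. -/
theorem UVCond.dvd_aligned_le (h : UVCond K U V) {α : ℕ}
    (hdim : ∀ m, α ≤ m → Module.finrank K (V m) = 1) {k s : ℕ} (hk : α ≤ k) (hs : α ≤ s)
    {b c : ℕ} (hb : 2 ^ α ∣ b) (hM : b + 2 ^ s + c = 2 ^ (k + 1)) :
    Adeg K b * U s * Adeg K c ≤ U k * Adeg K (2 ^ k) ⊔ Adeg K (2 ^ k) * U k := by
  induction s, hs using Nat.le_induction generalizing b c with
  | base => exact h.aligned_le hk hb hM
  | succ s hs ih =>
    refine (mul_le_mul_left (mul_le_mul_right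
      (h.U_succ_le (hdim s hs) (hdim (s + 1) (by omega))) _) _).trans ?_
    rw [Submodule.mul_sup, Submodule.sup_mul, ← mul_assoc, Adeg_mul, ← mul_assoc,
      mul_assoc _ (Adeg K (2 ^ s)) (Adeg K c), Adeg_mul]
    rw [pow_succ] at hM
    exact sup_le (ih (hb.add (pow_dvd_pow 2 hs)) (by omega)) (ih hb (by omega))

variable (U) in
/-- The complement of `prodLow` in `A(2^i k)`. -/
def complLow (i k : ℕ) : Submodule K (FA K) :=
  if _h : k = 0 then ⊥
  else if k % 2 = 1 then
    U i * Adeg K (2 ^ (i + 1) * (k / 2)) ⊔ Adeg K (2 ^ i) * complLow (i + 1) (k / 2)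
  else complLow (i + 1) (k / 2)
termination_by k
decreasing_by all_goals exact Nat.div_lt_self (Nat.pos_of_ne_zero _h) one_lt_two

variable (U) in
/-- The complement of `prodHigh` in `A(2^i k)`. -/
def complHigh (i k : ℕ) : Submodule K (FA K) :=
  if _h : k = 0 then ⊥
  else if k % 2 = 1 then
    Adeg K (2 ^ (i + 1) * (k / 2)) * U i ⊔ complHigh (i + 1) (k / 2) * Adeg K (2 ^ i)
  else complHigh (i + 1) (k / 2)
termination_by k
decreasing_by all_goals exact Nat.div_lt_self (Nat.pos_of_ne_zero _h) one_lt_two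

theorem two_pow_mul_odd {k : ℕ} (i : ℕ) (hk : k % 2 = 1) :
    2 ^ i * k = 2 ^ i + 2 ^ (i + 1) * (k / 2) := by
  conv_lhs => rw [← Nat.div_add_mod k 2, hk]
  ring

theorem two_pow_mul_even {k : ℕ} (i : ℕ) (hk : ¬ k % 2 = 1) :
    2 ^ i * k = 2 ^ (i + 1) * (k / 2) := by
  conv_lhs => rw [← Nat.div_add_mod k 2, show k % 2 = 0 by omega]
  ring

theorem UVCond.prodLow_le (h : UVCond K U V) (i k : ℕ) :
    prodLow K V i k ≤ Adeg K (2 ^ i * k) := by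
  induction k using Nat.strong_induction_on generalizing i with
  | _ k ih =>
    rw [prodLow]
    split_ifs with h0 h1
    · rw [h0, mul_zero, Adeg_zero]
    · rw [two_pow_mul_odd i h1, ← Adeg_mul]
      exact mul_le_mul' (h.V_le i)
        (ih _ (Nat.div_lt_self (Nat.pos_of_ne_zero h0) one_lt_two) _)
    · rw [two_pow_mul_even i h1, one_mul]
      exact ih _ (Nat.div_lt_self (Nat.pos_of_ne_zero h0) one_lt_two) _

theorem UVCond.adeg_le_low (h : UVCond K U V) (i k : ℕ) :
    Adeg K (2 ^ i * k) ≤ prodLow K V i k ⊔ complLow U i k := by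
  induction k using Nat.strong_induction_on generalizing i with
  | _ k ih =>
    rw [prodLow, complLow]
    split_ifs with h0 h1
    · rw [h0, mul_zero, Adeg_zero]
      exact le_sup_left
    · have := ih (k / 2) (Nat.div_lt_self (Nat.pos_of_ne_zero h0) one_lt_two) (i + 1)
      rw [two_pow_mul_odd i h1, ← Adeg_mul]
      refine (mul_le_mul_left (h.adeg_le i) _).trans ?_
      rw [Submodule.sup_mul]
      refine sup_le ((mul_le_mul_right this _).trans ?_)
        (le_sup_left.trans le_sup_right)
      rw [Submodule.mul_sup]
      exact sup_le_sup_left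
        ((mul_le_mul_left (h.V_le i) _).trans le_sup_right) _
    · rw [two_pow_mul_even i h1, one_mul]
      exact ih (k / 2) (Nat.div_lt_self (Nat.pos_of_ne_zero h0) one_lt_two) (i + 1)

theorem UVCond.adeg_le_high (h : UVCond K U V) (i k : ℕ) :
    Adeg K (2 ^ i * k) ≤ prodHigh K V i k ⊔ complHigh U i k := by
  induction k using Nat.strong_induction_on generalizing i with
  | _ k ih =>
    rw [prodHigh, complHigh]
    split_ifs with h0 h1
    · rw [h0, mul_zero, Adeg_zero]
      exact le_sup_left
    · have := ih (k / 2) (Nat.div_lt_self (Nat.pos_of_ne_zero h0) one_lt_two) (i + 1)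
      rw [two_pow_mul_odd i h1, add_comm, ← Adeg_mul]
      refine (mul_le_mul_right (h.adeg_le i) _).trans ?_
      rw [Submodule.mul_sup]
      refine sup_le ((mul_le_mul_left this _).trans ?_)
        (le_sup_left.trans le_sup_right)
      rw [Submodule.sup_mul]
      exact sup_le_sup_left
        ((mul_le_mul_right (h.V_le i) _).trans le_sup_right) _
    · rw [two_pow_mul_even i h1, mul_one]
      exact ih (k / 2) (Nat.div_lt_self (Nat.pos_of_ne_zero h0) one_lt_two) (i + 1)

theorem UVCond.complLow_le (h : UVCond K U V) {N l : ℕ} (hl : l ≤ N) {i k b c : ℕ}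
    (hdvd : 2 ^ l ∣ b + 2 ^ i * k) (hlt : 2 ^ i * k < 2 ^ l)
    (hM : b + 2 ^ i * k + c = 2 ^ (N + 1)) :
    Adeg K b * complLow U i k * Adeg K c ≤
      U N * Adeg K (2 ^ N) ⊔ Adeg K (2 ^ N) * U N := by
  induction k using Nat.strong_induction_on generalizing i b with
  | _ k ih =>
    rw [complLow]
    split_ifs with h0 h1
    · simp
    · have ih := ih (k / 2) (Nat.div_lt_self (Nat.pos_of_ne_zero h0) one_lt_two)
        (i := i + 1) (b := b + 2 ^ i)
      have hil : i < l := by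
        refine (Nat.pow_lt_pow_iff_right (a := 2) one_lt_two).1 (lt_of_le_of_lt ?_ hlt)
        exact Nat.le_mul_of_pos_right _ (Nat.pos_of_ne_zero h0)
      have hib : 2 ^ i ∣ b :=
        (Nat.dvd_add_left (Dvd.intro _ rfl)).1 ((pow_dvd_pow 2 hil.le).trans hdvd)
      rw [two_pow_mul_odd i h1] at hdvd hlt hM
      rw [Submodule.mul_sup, Submodule.sup_mul, ← mul_assoc, ← mul_assoc,
        mul_assoc _ _ (Adeg K c), Adeg_mul, Adeg_mul]
      exact sup_le (h.aligned_le (hil.le.trans hl) hib (by omega))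
        (ih (by rwa [add_assoc]) (by omega) (by omega))
    · rw [two_pow_mul_even i h1] at hdvd hlt hM
      exact ih (k / 2) (Nat.div_lt_self (Nat.pos_of_ne_zero h0) one_lt_two) hdvd hlt hM

theorem UVCond.complHigh_le (h : UVCond K U V) {α : ℕ}
    (hdim : ∀ m, α ≤ m → Module.finrank K (V m) = 1) {N l : ℕ} (hα : α ≤ N) (hl : l ≤ α)
    {i k b c : ℕ} (hdvd : 2 ^ l ∣ b) (hlt : l = α ∨ 2 ^ i * k < 2 ^ (l + 1))
    (hM : b + 2 ^ i * k + c = 2 ^ (N + 1)) :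
    Adeg K b * complHigh U i k * Adeg K c ≤
      U N * Adeg K (2 ^ N) ⊔ Adeg K (2 ^ N) * U N := by
  induction k using Nat.strong_induction_on generalizing i c with
  | _ k ih =>
    rw [complHigh]
    split_ifs with h0 h1
    · simp
    · have ih := ih (k / 2) (Nat.div_lt_self (Nat.pos_of_ne_zero h0) one_lt_two)
        (i := i + 1) (c := 2 ^ i + c)
      have hil : l = α ∨ i ≤ l := by
        refine hlt.imp_right fun hlt => Nat.lt_succ_iff.1 ?_
        refine (Nat.pow_lt_pow_iff_right (a := 2) one_lt_two).1 (lt_of_le_of_lt ?_ hlt)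
        exact Nat.le_mul_of_pos_right _ (Nat.pos_of_ne_zero h0)
      rw [two_pow_mul_odd i h1] at hlt hM
      rw [Submodule.mul_sup, Submodule.sup_mul, ← mul_assoc, ← mul_assoc,
        mul_assoc _ (Adeg K (2 ^ i)) (Adeg K c), Adeg_mul, Adeg_mul]
      refine sup_le ?_ (ih (hlt.imp_right (lt_of_le_of_lt (Nat.le_add_left _ _))) (by omega))
      by_cases hi : i ≤ l
      · refine h.aligned_le ((hi.trans hl).trans hα) (((pow_dvd_pow 2 hi).trans hdvd).add ?_)
          (by omega)
        exact (pow_dvd_pow 2 (Nat.le_succ i)).trans (Dvd.intro _ rfl)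
      · obtain rfl : l = α := hil.resolve_right hi
        refine h.dvd_aligned_le hdim hα (not_le.1 hi).le (hdvd.add ?_) (by omega)
        exact (pow_dvd_pow 2 (by omega)).trans (Dvd.intro _ rfl)
    · rw [two_pow_mul_even i h1] at hlt hM
      exact ih (k / 2) (Nat.div_lt_self (Nat.pos_of_ne_zero h0) one_lt_two) hlt hM

/-- An interval `[a, a + n]` contains a most divisible point `a + t`, where divisibility by powers
of `2` is only tested up to `2 ^ α`. -/
theorem exists_split_point (a n α : ℕ) :
    ∃ l t, l ≤ α ∧ t ≤ n ∧ 2 ^ l ∣ a + t ∧ t < 2 ^ l ∧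
      (l = α ∨ n - t < 2 ^ (l + 1)) := by
  induction α with
  | zero => exact ⟨0, 0, le_rfl, Nat.zero_le _, by simp, by simp, Or.inl rfl⟩
  | succ α ih =>
    obtain ⟨l, t, hl, htn, hdvd, hlt, hor⟩ := ih
    by_cases hsmall : n - t < 2 ^ (l + 1)
    · by_cases h2 : ∃ t' ≤ n, 2 ^ (α + 1) ∣ a + t' ∧ t' < 2 ^ (α + 1)
      · obtain ⟨t', h1, h2, h3⟩ := h2
        exact ⟨α + 1, t', le_rfl, h1, h2, h3, Or.inl rfl⟩
      · exact ⟨l, t, by omega, htn, hdvd, hlt, Or.inr hsmall⟩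
    · obtain rfl : l = α := hor.resolve_right hsmall
      have hpos : 0 < 2 ^ l := by positivity
      have hs : 2 ^ (l + 1) = 2 * 2 ^ l := by ring
      obtain ⟨j, hj⟩ := hdvd
      obtain ⟨i, rfl | rfl⟩ := Nat.even_or_odd' j
      · exact ⟨l + 1, t, le_rfl, htn, ⟨i, by rw [hj]; ring⟩, by omega, Or.inl rfl⟩
      · exact ⟨l + 1, t + 2 ^ l, le_rfl, by omega, ⟨i + 1, by rw [← add_assoc, hj]; ring⟩,
          by omega, Or.inl rfl⟩

end Dyadic

section Insertion

variable {K}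

/-- The elements `x` such that `p * x * q ∈ B` for all monomials `p`, `q` whose degrees sum to
`M - n`, with `deg p ≡ a` modulo `D`. -/
def insertionKer (B : Submodule K (FA K)) (a n D M : ℕ) : Submodule K (FA K) where
  carrier := { x | ∀ b c, b ≡ a [MOD D] → b + n + c = M →
    ∀ p ∈ Mon K b, ∀ q ∈ Mon K c, p * x * q ∈ B }
  add_mem' hx hy b c hb hM p hp q hq := by
    rw [mul_add, add_mul]
    exact B.add_mem (hx b c hb hM p hp q hq) (hy b c hb hM p hp q hq)
  zero_mem' b c hb hM p hp q hq := by simp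
  smul_mem' t x hx b c hb hM p hp q hq := by
    rw [mul_smul_comm, smul_mul_assoc]
    exact B.smul_mem t (hx b c hb hM p hp q hq)

theorem le_insertionKer {B X : Submodule K (FA K)} {a n D M : ℕ}
    (h : ∀ b c, b ≡ a [MOD D] → b + n + c = M → Adeg K b * X * Adeg K c ≤ B) :
    X ≤ insertionKer B a n D M :=
  fun _ hx b c hb hM _ hp _ hq => h b c hb hM
    (Submodule.mul_mem_mul (Submodule.mul_mem_mul (Submodule.subset_span hp) hx)
      (Submodule.subset_span hq))

theorem UVCond.exists_adeg_le {U V : ℕ → Submodule K (FA K)} (h : UVCond K U V) {α : ℕ}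
    (hdim : ∀ m, α ≤ m → Module.finrank K (V m) = 1) {k : ℕ} (hk : α ≤ k) (a n : ℕ) :
    ∃ t ≤ n, Adeg K n ≤ Vlt K V t * Vgt K V (n - t) ⊔
      insertionKer (U k * Adeg K (2 ^ k) ⊔ Adeg K (2 ^ k) * U k) a n (2 ^ α)
        (2 ^ (k + 1)) := by
  obtain ⟨l, t, hl, htn, hdvd, hlt, hor⟩ := exists_split_point a n α
  refine ⟨t, htn, ?_⟩
  have hdvd' : ∀ b, b ≡ a [MOD 2 ^ α] → 2 ^ l ∣ b + t := fun b hb =>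
    ((((hb.of_dvd (pow_dvd_pow 2 hl)).add_right t).dvd_iff dvd_rfl).2 hdvd)
  have hlow := h.adeg_le_low 0 t
  have hhigh := h.adeg_le_high 0 (n - t)
  rw [pow_zero, one_mul] at hlow hhigh
  have hV := h.prodLow_le 0 t
  rw [pow_zero, one_mul] at hV
  calc Adeg K n = Adeg K t * Adeg K (n - t) := by rw [Adeg_mul, Nat.add_sub_cancel' htn]
    _ ≤ prodLow K V 0 t * (prodHigh K V 0 (n - t) ⊔ complHigh U 0 (n - t)) ⊔
        complLow U 0 t * Adeg K (n - t) := by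
      refine (mul_le_mul_left hlow _).trans ?_
      rw [Submodule.sup_mul]
      exact sup_le_sup_right (mul_le_mul_right hhigh _) _
    _ ≤ _ := by
      rw [Submodule.mul_sup]
      refine sup_le (sup_le_sup_left ?_ _) (le_sup_of_le_right ?_)
      · refine (mul_le_mul_left hV _).trans (le_insertionKer fun b c hb hM => ?_)
        rw [← mul_assoc, Adeg_mul]
        exact h.complHigh_le hdim hk hl (hdvd' b hb) (by simpa using hor) (by omega)
      · refine le_insertionKer fun b c hb hM => ?_
        rw [← mul_assoc, mul_assoc _ _ (Adeg K c), Adeg_mul]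
        exact h.complLow_le (hl.trans hk) (by simpa using hdvd' b hb) (by simpa using hlt)
          (by omega)

theorem prod_ofFn_mem_Mon {N n : ℕ} {x r : Fin N → FA K} {dr : Fin N → ℕ}
    (hx : ∀ i, x i ∈ Mon K n) (hr : ∀ i, r i ∈ Mon K (dr i)) :
    (List.ofFn fun i => x i * r i).prod ∈ Mon K (∑ i, (n + dr i)) := by
  induction N with
  | zero => simpa using Mon.one_mem
  | succ N ih =>
    rw [List.ofFn_succ, List.prod_cons, Fin.sum_univ_succ]
    exact Mon.mul_mem (Mon.mul_mem (hx 0) (hr 0)) (ih (fun i => hx i.succ) fun i => hr i.succ)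

theorem prod_ofFn_mem {B : Submodule K (FA K)} {a n D M N : ℕ} {x r : Fin N → FA K}
    {dr : Fin N → ℕ} (hr : ∀ i, r i ∈ Mon K (dr i)) (hdvd : ∀ i, D ∣ dr i + n) (j : Fin N)
    (hj : x j ∈ insertionKer B a n D M) (hx : ∀ i, i ≠ j → x i ∈ Mon K n) {b c : ℕ}
    (hb : b ≡ a [MOD D]) (hM : b + ∑ i, (n + dr i) + c = M) {p q : FA K}
    (hp : p ∈ Mon K b) (hq : q ∈ Mon K c) :
    p * (List.ofFn fun i => x i * r i).prod * q ∈ B := by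
  induction N generalizing b p with
  | zero => exact j.elim0
  | succ N ih =>
    rw [List.ofFn_succ, List.prod_cons]
    rw [Fin.sum_univ_succ] at hM
    induction j using Fin.cases with
    | zero =>
      have hrest := prod_ofFn_mem_Mon (fun i : Fin N => hx i.succ (Fin.succ_ne_zero i))
        fun i => hr i.succ
      have := hj b _ hb (by omega) p hp _ (Mon.mul_mem (Mon.mul_mem (hr 0) hrest) hq)
      simpa only [mul_assoc] using this
    | succ j =>
      have hb' : b + (n + dr 0) ≡ a [MOD D] := by
        have h0 : n + dr 0 ≡ 0 [MOD D] := by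
          rw [Nat.modEq_zero_iff_dvd, add_comm]
          exact hdvd 0
        simpa using hb.add h0
      have := ih (fun i => hr i.succ) (fun i => hdvd i.succ) j hj
        (fun i hi => hx i.succ fun h => hi (Fin.succ_injective _ h)) hb' (by omega)
        (Mon.mul_mem hp (Mon.mul_mem (hx 0 (Fin.succ_ne_zero j).symm) (hr 0)))
      simpa only [mul_assoc] using this

/-- `d_N(x; r)`, multiplied by `p` and `q` and taken modulo `B`, is the alternatization of this
multilinear map. -/
def sandwich (B : Submodule K (FA K)) (p q : FA K) {N : ℕ} (r : Fin N → FA K) :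
    MultilinearMap K (fun _ : Fin N => FA K) (FA K ⧸ B) :=
  (B.mkQ ∘ₗ LinearMap.mulRight K q ∘ₗ LinearMap.mulLeft K p).compMultilinearMap
    ((MultilinearMap.mkPiAlgebraFin K N (FA K)).compLinearMap
      fun i => LinearMap.mulRight K (r i))

theorem sandwich_apply (B : Submodule K (FA K)) (p q : FA K) {N : ℕ} (r x : Fin N → FA K) :
    sandwich B p q r x = B.mkQ (p * (List.ofFn fun i => x i * r i).prod * q) := by
  simp [sandwich]

theorem alternatization_sandwich (B : Submodule K (FA K)) (p q : FA K) {N : ℕ}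
    (r x : Fin N → FA K) :
    MultilinearMap.alternatization (sandwich B p q r) x = B.mkQ (p * capelli N x r * q) := by
  rw [MultilinearMap.alternatization_apply, capelli, Finset.mul_sum, Finset.sum_mul, map_sum]
  refine Finset.sum_congr rfl fun σ _ => ?_
  rw [MultilinearMap.domDomCongr_apply, sandwich_apply, List.ofFn_eq_map, mul_smul_comm,
    smul_mul_assoc, map_zsmul]
  rfl

theorem capelli_mem {B : Submodule K (FA K)} {n D M N b c : ℕ} {x r : Fin N → FA K}
    {dr : Fin N → ℕ} (hx : ∀ i, x i ∈ Mon K n) (hr : ∀ i, r i ∈ Mon K (dr i))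
    (hdvd : ∀ i, D ∣ dr i + n) (hM : b + ∑ i, (n + dr i) + c = M) {p q : FA K}
    (hp : p ∈ Mon K b) (hq : q ∈ Mon K c) {g : Fin N → K} {j : Fin N} (hg : g j ≠ 0)
    (hsum : ∑ i, g i • x i ∈ insertionKer B b n D M) :
    p * capelli N x r * q ∈ B := by
  set H := MultilinearMap.alternatization (sandwich B p q r) with hH
  have h1 : H (Function.update x j (∑ i, g i • x i)) = g j • H x := by
    rw [AlternatingMap.map_update_sum, Finset.sum_eq_single j]
    · rw [AlternatingMap.map_update_smul, Function.update_eq_self]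
    · intro i _ hi
      rw [AlternatingMap.map_update_smul, AlternatingMap.map_update_self _ _ hi.symm, smul_zero]
    · simp
  have h2 : H (Function.update x j (∑ i, g i • x i)) = 0 := by
    rw [hH, MultilinearMap.alternatization_apply]
    refine Finset.sum_eq_zero fun σ _ => ?_
    rw [MultilinearMap.domDomCongr_apply, sandwich_apply]
    have : p * (List.ofFn fun i => Function.update x j (∑ i, g i • x i) (σ i) * r i).prod * q
        ∈ B := by
      refine prod_ofFn_mem hr hdvd (σ.symm j) ?_ (fun i hi => ?_) (Nat.ModEq.refl b) hM hp hq
      · simpa using hsum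
      · have hne : σ i ≠ j := fun h => hi (by simp [← h])
        simpa [hne] using hx (σ i)
    rw [Submodule.mkQ_apply, (Submodule.Quotient.mk_eq_zero B).2 this, smul_zero]
  have h3 : H x = 0 := (smul_eq_zero.1 (h1.symm.trans h2)).resolve_left hg
  rwa [hH, alternatization_sandwich, Submodule.mkQ_apply, Submodule.Quotient.mk_eq_zero] at h3

theorem capelli_mem_Adeg {n N : ℕ} {x r : Fin N → FA K} {dr : Fin N → ℕ}
    (hx : ∀ i, x i ∈ Mon K n) (hr : ∀ i, r i ∈ Mon K (dr i)) :
    capelli N x r ∈ Adeg K (∑ i, (n + dr i)) := by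
  refine Submodule.sum_mem _ fun σ _ => zsmul_mem (Submodule.subset_span ?_) _
  rw [← List.ofFn_eq_map]
  exact prod_ofFn_mem_Mon (fun i => hx (σ i)) hr

/-- More vectors than the dimension of a complement of `W` are linearly dependent modulo `W`. -/
theorem exists_sum_smul_mem {M : Type*} [AddCommGroup M] [Module K M] {P W : Submodule K M}
    {c : ℕ} (hP : Module.rank K P ≤ (c : Cardinal)) {x : Fin (c + 1) → M}
    (hx : ∀ i, x i ∈ P ⊔ W) :
    ∃ g : Fin (c + 1) → K, (∑ i, g i • x i ∈ W) ∧ ∃ j, g j ≠ 0 := by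
  choose v hv w hw hvw using fun i => Submodule.mem_sup.1 (hx i)
  have hdep : ¬ LinearIndependent K fun i => (⟨v i, hv i⟩ : P) := by
    intro hli
    have hle := hli.cardinal_lift_le_rank.trans (Cardinal.lift_le.2 hP)
    rw [Cardinal.mk_fin, Cardinal.lift_natCast, Cardinal.lift_natCast, Nat.cast_le] at hle
    omega
  obtain ⟨g, hg, j, hj⟩ := Fintype.not_linearIndependent_iff.1 hdep
  refine ⟨g, ?_, j, hj⟩
  have hg' : ∑ i, g i • v i = 0 := by
    simpa using congrArg Subtype.val hg
  have : ∑ i, g i • x i = ∑ i, g i • w i := by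
    simp only [← hvw, smul_add, Finset.sum_add_distrib, hg', zero_add]
  rw [this]
  exact Submodule.sum_mem _ fun i _ => W.smul_mem _ (hw i)

end Insertion

/-- **Lemma 2.2.**  Capelli polynomials of size `c+1` in monomials `m_i` of a common degree
`n`, with separators `r_i` whose degrees satisfy `2^α ∣ deg r_i + n`, lie in `E`. -/
theorem statement7 (U V : ℕ → Submodule K (FA K)) (hUV : UVCond K U V)
    (α : ℕ) (hα : 1 ≤ α) (hdim : ∀ m, α ≤ m → Module.finrank K (V m) = 1)
    (c : ℕ)
    (hc : ∀ n : ℕ,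
      Module.rank K ↥(⨆ i ∈ Finset.range (n + 1), Vlt K V i * Vgt K V (n - i)) ≤
        (c : Cardinal))
    (n : ℕ) (hn : 1 ≤ n)
    (m : Fin (c + 1) → FA K) (hm : ∀ i, m i ∈ Mon K n)
    (r : Fin (c + 1) → FA K) (dr : Fin (c + 1) → ℕ)
    (hrmon : ∀ i, r i ∈ Mon K (dr i)) (hdvd : ∀ i, 2 ^ α ∣ dr i + n) :
    capelli (c + 1) m r ∈ Esub K U := by
  have hdeg : ∀ i, 2 ^ α ∣ n + dr i := fun i => add_comm (dr i) n ▸ hdvd i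
  set N := ∑ i, (n + dr i) with hN
  have hN1 : 1 ≤ N := by
    rw [hN, Fin.sum_univ_succ]
    omega
  have hαN : 2 ^ α ≤ N := Nat.le_of_dvd hN1 (Finset.dvd_sum fun i _ => hdeg i)
  have hαk : α ≤ Nat.log 2 N + 1 :=
    (Nat.le_log_of_pow_le one_lt_two hαN).trans (Nat.le_succ _)
  refine Submodule.subset_span (Set.mem_biUnion (Set.mem_Ici.2 hN1) ⟨capelli_mem_Adeg hm hrmon,
    ideal_inf_Adeg_le (capelli_mem_Adeg hm hrmon) fun a b hab e he f hf => ?_⟩)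
  obtain ⟨t, htn, ht⟩ := hUV.exists_adeg_le hdim hαk a n
  have hrank := (Submodule.rank_mono (le_biSup (fun i => Vlt K V i * Vgt K V (n - i))
    (Finset.mem_range.2 (Nat.lt_succ_of_le htn)))).trans (hc n)
  obtain ⟨g, hg, j, hj⟩ := exists_sum_smul_mem hrank fun i => ht (Submodule.subset_span (hm i))
  exact capelli_mem hm hrmon hdvd hab he hf hj hg

end
end
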